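/- arXiv:1409.8188 — 2 statements merged into one kernel-verified Lean document; each statement's English description precedes it below -/
import Mathlib

section
/- For every natural number N and all indices γ, μ, ν in Fin n, the following identity holds in the polynomial ring k[X_1,…,X_n]: ∑_{p+q=N+1} (B_p/p!)·(B_q/q!) · ∑_ρ [ δ_ρ((𝒞^p)^γ_μ) · (𝒞^q)^ρ_ν − δ_ρ((𝒞^p)^γ_ν) · (𝒞^q)^ρ_μ ] = −(B_N/N!) · ∑_σ C^σ_{μν} · (𝒞^N)^γ_σ, where the outer sum is over pairs of natural numbers (p,q) with p+q = N+1. (This is the degree-N homogeneous component of the power-series identity (δ_ρ φ̃^γ_μ) φ̃^ρ_ν − (δ_ρ φ̃^γ_ν) φ̃^ρ_μ = −C^σ_{μν} φ̃^γ_σ, which expresses that the elements ŷ_μ = x_σ φ̃^σ_μ of the completed Weyl algebra satisfy the opposite Lie algebra relations [ŷ_μ, ŷ_ν] = −C^λ_{μν} ŷ_λ.) -/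
open Finset MvPolynomial

/-- The functional equation of `F(t) = t / (e^t - 1)`, as an identity of power series in `t`. -/
theorem rescale_bernoulliPowerSeries_functional_equation {A : Type*} [CommRing A] [IsDomain A]
    [Algebra ℚ A] {x y : A} (hx : x ≠ 0) (hy : y ≠ 0) (hxy : x + y ≠ 0) :
    PowerSeries.C x *
          ((PowerSeries.rescale (x + y) (bernoulliPowerSeries A) -
            PowerSeries.rescale x (bernoulliPowerSeries A)) *
          PowerSeries.rescale y (bernoulliPowerSeries A)) +
        PowerSeries.C y *
          ((PowerSeries.rescale (x + y) (bernoulliPowerSeries A) -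
            PowerSeries.rescale y (bernoulliPowerSeries A)) *
          PowerSeries.rescale x (bernoulliPowerSeries A)) =
      -(PowerSeries.C (x * y) *
        (PowerSeries.X * PowerSeries.rescale (x + y) (bernoulliPowerSeries A))) := by
  have key (z : A) : PowerSeries.rescale z (bernoulliPowerSeries A) *
      (PowerSeries.rescale z (PowerSeries.exp A) - 1) = PowerSeries.C z * PowerSeries.X := by
    simpa [PowerSeries.rescale_X] using
      congrArg (PowerSeries.rescale z) (bernoulliPowerSeries_mul_exp_sub_one A)
  have ne {z : A} (hz : z ≠ 0) : PowerSeries.rescale z (PowerSeries.exp A) - 1 ≠ 0 := by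
    intro h
    have h' := key z
    rw [h, mul_zero] at h'
    have h1 := congrArg (PowerSeries.coeff 1) h'
    simp at h1
    exact hz h1.symm
  have kx := key x
  have ky := key y
  have kxy := key (x + y)
  have nx := ne hx
  have ny := ne hy
  have nxy := ne hxy
  rw [← PowerSeries.exp_mul_exp_eq_exp_add, map_add] at kxy
  rw [← PowerSeries.exp_mul_exp_eq_exp_add] at nxy
  rw [map_mul]
  generalize PowerSeries.rescale x (PowerSeries.exp A) = Ex at *
  generalize PowerSeries.rescale y (PowerSeries.exp A) = Ey at *
  generalize PowerSeries.rescale x (bernoulliPowerSeries A) = Fx at *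
  generalize PowerSeries.rescale y (bernoulliPowerSeries A) = Fy at *
  generalize PowerSeries.rescale (x + y) (bernoulliPowerSeries A) = Fz at *
  generalize PowerSeries.C x = a at *
  generalize PowerSeries.C y = b at *
  generalize (PowerSeries.X : PowerSeries A) = t at *
  apply mul_right_cancel₀ (mul_ne_zero (mul_ne_zero nx ny) nxy)
  have hxy' : Fx * (Ex - 1) * (Fy * (Ey - 1)) = a * t * (b * t) := by rw [kx, ky]
  have hxz : Fx * (Ex - 1) * (Fz * (Ex * Ey - 1)) = a * t * ((a + b) * t) := by rw [kx, kxy]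
  have hyz : Fy * (Ey - 1) * (Fz * (Ex * Ey - 1)) = b * t * ((a + b) * t) := by rw [ky, kxy]
  linear_combination a * (Ex - 1) * hyz + b * (Ey - 1) * hxz - (a + b) * (Ex * Ey - 1) * hxy' +
    a * b * t * (Ex - 1) * (Ey - 1) * kxy

/-- The homogeneous components of the functional equation of `t / (e^t - 1)`, with the
denominators `x` and `y` cleared by geometric sums. -/
theorem sum_antidiagonal_bernoulli_mul_geom_sum {A : Type*} [CommRing A] [IsDomain A]
    [Algebra ℚ A] {x y : A} (hx : x ≠ 0) (hy : y ≠ 0) (hxy : x + y ≠ 0) (N : ℕ) :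
    ∑ pq ∈ antidiagonal (N + 1),
        algebraMap ℚ A (bernoulli pq.1 / pq.1.factorial * (bernoulli pq.2 / pq.2.factorial)) *
          ∑ i ∈ range pq.1, ((x + y) ^ i * (x ^ (pq.1 - 1 - i) * y ^ pq.2) +
            (x + y) ^ i * (x ^ pq.2 * y ^ (pq.1 - 1 - i))) =
      -(algebraMap ℚ A (bernoulli N / N.factorial) * (x + y) ^ N) := by
  have h := congrArg (PowerSeries.coeff (N + 1))
    (rescale_bernoulliPowerSeries_functional_equation hx hy hxy)
  rw [map_add, map_neg, PowerSeries.coeff_C_mul, PowerSeries.coeff_C_mul, PowerSeries.coeff_C_mul,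
    PowerSeries.coeff_succ_X_mul, PowerSeries.coeff_mul, PowerSeries.coeff_mul] at h
  simp only [map_sub, PowerSeries.coeff_rescale, bernoulliPowerSeries, PowerSeries.coeff_mk] at h
  apply mul_left_cancel₀ (mul_ne_zero hx hy)
  refine Eq.trans ?_ (h.trans (by ring))
  rw [mul_sum, mul_sum, mul_sum, ← sum_add_distrib]
  refine sum_congr rfl fun pq _ => ?_
  have h1 := (Commute.all (x + y) x).geom_sum₂_mul pq.1
  have h2 := (Commute.all (x + y) y).geom_sum₂_mul pq.1
  rw [add_sub_cancel_left] at h1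
  rw [add_sub_cancel_right] at h2
  simp only [← mul_assoc]
  rw [sum_add_distrib, ← sum_mul]
  simp only [mul_right_comm _ (x ^ pq.2)]
  rw [← sum_mul, map_mul]
  linear_combination (algebraMap ℚ A (bernoulli pq.1 / pq.1.factorial) *
    algebraMap ℚ A (bernoulli pq.2 / pq.2.factorial)) * (x * y ^ pq.2 * h1 + y * x ^ pq.2 * h2)

/-- If `D` is a derivation of the bilinear product `B`, then the functional equation of
`t / (e^t - 1)` holds with `x` and `y` acting as `D` on the two arguments of `B`. -/
theorem sum_antidiagonal_bernoulli_smul_derivation {R V : Type*} [CommRing R] [IsDomain R]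
    [Algebra ℚ R] [AddCommGroup V] [Module R V] (D : Module.End R V) (B : V →ₗ[R] V →ₗ[R] V)
    (hD : ∀ a b, D (B a b) = B (D a) b + B a (D b)) (u v : V) (N : ℕ) :
    ∑ pq ∈ antidiagonal (N + 1),
        algebraMap ℚ R (bernoulli pq.1 / pq.1.factorial * (bernoulli pq.2 / pq.2.factorial)) •
          ∑ i ∈ range pq.1, ((D ^ i) (B ((D ^ (pq.1 - 1 - i)) u) ((D ^ pq.2) v)) +
            (D ^ i) (B ((D ^ pq.2) u) ((D ^ (pq.1 - 1 - i)) v))) =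
      -(algebraMap ℚ R (bernoulli N / N.factorial) • (D ^ N) (B u v)) := by
  set Φ : MvPolynomial (Fin 2) R →ₗ[R] V :=
    (basisMonomials (Fin 2) R).constr R fun s => B ((D ^ s 0) u) ((D ^ s 1) v) with hΦ
  have hmon (s : Fin 2 →₀ ℕ) : Φ (monomial s 1) = B ((D ^ s 0) u) ((D ^ s 1) v) := by
    simpa only [coe_basisMonomials] using (basisMonomials (Fin 2) R).constr_basis R
      (fun s : Fin 2 →₀ ℕ => B ((D ^ s 0) u) ((D ^ s 1) v)) s
  have hXY (a b : ℕ) : Φ (X 0 ^ a * X 1 ^ b) = B ((D ^ a) u) ((D ^ b) v) := by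
    rw [X_pow_eq_monomial, X_pow_eq_monomial, monomial_mul, one_mul, hmon]
    simp
  have hmul (P : MvPolynomial (Fin 2) R) : Φ ((X 0 + X 1) * P) = D (Φ P) := by
    have : Φ ∘ₗ LinearMap.mulLeft R (X 0 + X 1) = D ∘ₗ Φ := by
      refine (basisMonomials (Fin 2) R).ext fun s => ?_
      rw [coe_basisMonomials]
      simp only [LinearMap.comp_apply, LinearMap.mulLeft_apply, add_mul, map_add, hmon, hD]
      rw [X, X, monomial_mul, monomial_mul, one_mul, hmon, hmon]
      simp [pow_add]
    exact LinearMap.congr_fun this P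
  have hpow (i : ℕ) (P : MvPolynomial (Fin 2) R) :
      Φ ((X 0 + X 1) ^ i * P) = (D ^ i) (Φ P) := by
    induction i with
    | zero => simp
    | succ i ih => rw [pow_succ', mul_assoc, hmul, ih, pow_succ', Module.End.mul_apply]
  have hsum : (X 0 + X 1 : MvPolynomial (Fin 2) R) ≠ 0 := by
    intro h
    simpa using congrArg (eval ![1, 0]) h
  have h := congrArg Φ (sum_antidiagonal_bernoulli_mul_geom_sum
    (X_ne_zero (R := R) (0 : Fin 2)) (X_ne_zero 1) hsum N)
  have hone : Φ 1 = B u v := by simpa using hXY 0 0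
  have hpow_one := hpow N 1
  rw [mul_one, hone] at hpow_one
  simp only [IsScalarTower.algebraMap_apply ℚ R (MvPolynomial (Fin 2) R), ← Algebra.smul_def,
    map_sum, map_neg, map_smul, map_add, hpow, hXY, hpow_one] at h
  exact h

theorem Matrix.map_derivation_pow {k A m : Type*} [CommRing k] [CommRing A] [Algebra k A]
    [Fintype m] [DecidableEq m] (d : Derivation k A A) (M : Matrix m m A) (p : ℕ) :
    (M ^ p).map d = ∑ i ∈ range p, M ^ i * (M.map d * M ^ (p - 1 - i)) := by
  induction p with
  | zero => ext i j; by_cases h : i = j <;> simp [h]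
  | succ p ih =>
    have hmul (K L : Matrix m m A) : (K * L).map d = K * L.map d + K.map d * L := by
      ext i j
      simp [Matrix.mul_apply, sum_add_distrib, mul_comm]
    rw [pow_succ', hmul, ih, sum_range_succ', mul_sum]
    congr 1
    · refine sum_congr rfl fun i _ => ?_
      rw [pow_succ', mul_assoc, show p + 1 - 1 - (i + 1) = p - 1 - i by omega]
    · simp

/-- The bilinear product on `Fin n → R` with structure constants `c`. -/
def structureConstantsBilin {R : Type*} [CommRing R] {n : ℕ} (c : Fin n → Fin n → Fin n → R) :
    (Fin n → R) →ₗ[R] (Fin n → R) →ₗ[R] (Fin n → R) :=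
  LinearMap.mk₂ R (fun a b l => ∑ i, ∑ j, c l i j * a i * b j)
    (fun a a' b => by ext l; simp [mul_add, add_mul, sum_add_distrib])
    (fun r a b => by
      ext l
      simp only [Pi.smul_apply, smul_eq_mul, mul_sum]
      exact sum_congr rfl fun i _ => sum_congr rfl fun j _ => by ring)
    (fun a b b' => by ext l; simp [mul_add, sum_add_distrib])
    (fun r a b => by
      ext l
      simp only [Pi.smul_apply, smul_eq_mul, mul_sum]
      exact sum_congr rfl fun i _ => sum_congr rfl fun j _ => by ring)

theorem structureConstantsBilin_apply {R : Type*} [CommRing R] {n : ℕ}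
    (c : Fin n → Fin n → Fin n → R) (a b : Fin n → R) (l : Fin n) :
    structureConstantsBilin c a b l = ∑ i, ∑ j, c l i j * a i * b j := rfl

theorem structureConstantsBilin_swap {R : Type*} [CommRing R] {n : ℕ}
    {c : Fin n → Fin n → Fin n → R} (hc : ∀ l i j, c l i j = -c l j i) (a b : Fin n → R) :
    structureConstantsBilin c a b = -structureConstantsBilin c b a := by
  ext l
  rw [Pi.neg_apply, structureConstantsBilin_apply, structureConstantsBilin_apply, sum_comm,
    ← sum_neg_distrib]
  refine sum_congr rfl fun i _ => ?_
  rw [← sum_neg_distrib]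
  refine sum_congr rfl fun j _ => ?_
  rw [hc l j i]
  ring

/-- Bracketing with a fixed vector `x` on the right is a derivation. -/
theorem structureConstantsBilin_leibniz {R : Type*} [CommRing R] {n : ℕ}
    {c : Fin n → Fin n → Fin n → R} (hc : ∀ l i j, c l i j = -c l j i)
    (hjac : ∀ i j t s, ∑ r, (c r i j * c s r t + c r j t * c s r i + c r t i * c s r j) = 0)
    (x a b : Fin n → R) :
    structureConstantsBilin c (structureConstantsBilin c a b) x =
      structureConstantsBilin c (structureConstantsBilin c a x) b +
        structureConstantsBilin c a (structureConstantsBilin c b x) := by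
  rw [structureConstantsBilin_swap hc a (structureConstantsBilin c b x)]
  have expand (a b x : Fin n → R) (s : Fin n) :
      structureConstantsBilin c (structureConstantsBilin c a b) x s =
        ∑ i, ∑ j, ∑ t, (∑ r, c r i j * c s r t) * (a i * b j * x t) := by
    simp only [structureConstantsBilin_apply, mul_sum, sum_mul]
    rw [sum_comm_cycle]
    refine sum_congr rfl fun i _ => ?_
    rw [sum_comm_cycle]
    refine sum_congr rfl fun j _ => ?_
    rw [sum_comm]
    exact sum_congr rfl fun t _ => sum_congr rfl fun r _ => by ring
  have expand_right (s : Fin n) :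
      structureConstantsBilin c (structureConstantsBilin c a x) b s =
        ∑ i, ∑ j, ∑ t, (∑ r, c r i t * c s r j) * (a i * x t * b j) :=
    (expand a x b s).trans (sum_congr rfl fun i _ => sum_comm)
  have expand_cycle (s : Fin n) :
      structureConstantsBilin c (structureConstantsBilin c b x) a s =
        ∑ i, ∑ j, ∑ t, (∑ r, c r j t * c s r i) * (b j * x t * a i) :=
    (expand b x a s).trans sum_comm_cycle
  ext s
  rw [Pi.add_apply, Pi.neg_apply, expand, expand_right, expand_cycle, ← sub_eq_add_neg]
  simp only [← sum_sub_distrib]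
  refine sum_congr rfl fun i _ => sum_congr rfl fun j _ => sum_congr rfl fun t _ => ?_
  have h := hjac i j t s
  simp only [sum_add_distrib, hc _ t i, neg_mul, sum_neg_distrib] at h
  linear_combination (a i * b j * x t) * h

theorem sum_pderiv_pow_mul {k : Type*} [Field k] {n : ℕ}
    {c : Fin n → Fin n → Fin n → k} {M : Matrix (Fin n) (Fin n) (MvPolynomial (Fin n) k)}
    (hM : ∀ α β, M α β = ∑ g, MvPolynomial.C (c α β g) * X g) (p q : ℕ) (γ μ ν : Fin n) :
    ∑ ρ, pderiv ρ ((M ^ p) γ μ) * (M ^ q) ρ ν =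
      (∑ i ∈ range p, (M.toLin' ^ i) (structureConstantsBilin
        (fun α β g => (MvPolynomial.C (c α β g) : MvPolynomial (Fin n) k))
          ((M.toLin' ^ (p - 1 - i)) (Pi.single μ 1)) ((M.toLin' ^ q) (Pi.single ν 1)))) γ := by
  have hd (ρ α β : Fin n) : pderiv ρ (M α β) = MvPolynomial.C (c α β ρ) := by
    simp [hM, pderiv_X, Pi.single_apply]
  have hpow (ρ : Fin n) : pderiv ρ ((M ^ p) γ μ) =
      ∑ i ∈ range p, (M ^ i * (M.map (pderiv ρ) * M ^ (p - 1 - i))) γ μ := by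
    rw [← Matrix.sum_apply, ← Matrix.map_derivation_pow, Matrix.map_apply]
  simp only [hpow, sum_mul, Finset.sum_apply, ← Matrix.toLin'_pow]
  rw [sum_comm]
  refine sum_congr rfl fun i _ => ?_
  simp only [Matrix.mul_apply, Matrix.toLin'_apply, Matrix.mulVec_single_one, Matrix.mulVec,
    dotProduct, structureConstantsBilin_apply, Matrix.map_apply, hd, sum_mul, mul_sum,
    Matrix.col_apply]
  rw [sum_comm]
  refine sum_congr rfl fun a _ => ?_
  rw [sum_comm]
  exact sum_congr rfl fun b _ => sum_congr rfl fun e _ => by ring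

/-- Degree-`N` homogeneous component of
`(δ_ρ φ̃^γ_μ) φ̃^ρ_ν − (δ_ρ φ̃^γ_ν) φ̃^ρ_μ = −C^σ_{μν} φ̃^γ_σ`,
where `φ̃ = ∑_p (B_p/p!) 𝒞^p`. -/
theorem statement4 (k : Type*) [Field k] [CharZero k] (n : ℕ)
    (C : Fin n → Fin n → Fin n → k)
    (hanti : ∀ l μ ν, C l μ ν = - C l ν μ)
    (hjac : ∀ μ ν τ σ, ∑ ρ, (C ρ μ ν * C σ ρ τ + C ρ ν τ * C σ ρ μ + C ρ τ μ * C σ ρ ν) = 0)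
    (𝒞 : Matrix (Fin n) (Fin n) (MvPolynomial (Fin n) k))
    (h𝒞 : ∀ α β, 𝒞 α β = ∑ g, MvPolynomial.C (C α β g) * X g)
    (N : ℕ) (γ μ ν : Fin n) :
    ∑ pq ∈ antidiagonal (N + 1),
        MvPolynomial.C (((bernoulli pq.1 / pq.1.factorial) *
            (bernoulli pq.2 / pq.2.factorial) : ℚ) : k) *
          ∑ ρ, (pderiv ρ ((𝒞 ^ pq.1) γ μ) * (𝒞 ^ pq.2) ρ ν
            - pderiv ρ ((𝒞 ^ pq.1) γ ν) * (𝒞 ^ pq.2) ρ μ)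
      = - (MvPolynomial.C ((bernoulli N / N.factorial : ℚ) : k) *
          ∑ σ, MvPolynomial.C (C σ μ ν) * (𝒞 ^ N) γ σ) := by
  set c : Fin n → Fin n → Fin n → MvPolynomial (Fin n) k :=
    fun α β g => MvPolynomial.C (C α β g) with hc
  have hc_anti (l i j) : c l i j = -c l j i := by
    simp only [hc]
    rw [hanti, map_neg]
  have hc_jac (i j t s) :
      ∑ r, (c r i j * c s r t + c r j t * c s r i + c r t i * c s r j) = 0 := by
    simpa [hc] using congrArg (MvPolynomial.C (σ := Fin n)) (hjac i j t s)
  have h_bracket (a : Fin n → MvPolynomial (Fin n) k) :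
      𝒞.toLin' a = structureConstantsBilin c a X := by
    ext1 α
    simp only [Matrix.toLin'_apply, Matrix.mulVec, dotProduct, structureConstantsBilin_apply,
      h𝒞, sum_mul]
    exact sum_congr rfl fun i _ => sum_congr rfl fun j _ => by simp only [hc]; ring
  have hD (a b : Fin n → MvPolynomial (Fin n) k) :
      𝒞.toLin' (structureConstantsBilin c a b) =
        structureConstantsBilin c (𝒞.toLin' a) b + structureConstantsBilin c a (𝒞.toLin' b) := by
    simp only [h_bracket, structureConstantsBilin_leibniz hc_anti hc_jac X a b]
  have halg (r : ℚ) : MvPolynomial.C (r : k) = algebraMap ℚ (MvPolynomial (Fin n) k) r := by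
    rw [IsScalarTower.algebraMap_apply ℚ k, eq_ratCast, algebraMap_eq]
  have h := congrFun (sum_antidiagonal_bernoulli_smul_derivation 𝒞.toLin'
    (structureConstantsBilin c) hD (Pi.single μ 1) (Pi.single ν 1) N) γ
  rw [Finset.sum_apply, Pi.neg_apply, Pi.smul_apply, smul_eq_mul, ← Matrix.toLin'_pow] at h
  have h_right : (𝒞 ^ N).toLin' (structureConstantsBilin c (Pi.single μ 1) (Pi.single ν 1)) γ =
      ∑ σ, MvPolynomial.C (C σ μ ν) * (𝒞 ^ N) γ σ := by
    simp only [Matrix.toLin'_apply, Matrix.mulVec, dotProduct]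
    refine sum_congr rfl fun σ _ => ?_
    simp [structureConstantsBilin_apply, hc, Pi.single_apply, mul_comm]
  rw [halg, ← h_right, ← h]
  refine sum_congr rfl fun pq _ => ?_
  rw [halg, Pi.smul_apply, smul_eq_mul, sum_sub_distrib, sum_pderiv_pow_mul h𝒞,
    sum_pderiv_pow_mul h𝒞, sum_add_distrib, Pi.add_apply, sub_eq_add_neg, ← Pi.neg_apply,
    ← sum_neg_distrib]
  simp only [← map_neg, ← structureConstantsBilin_swap hc_anti, ← hc]
end

section
/- For every natural number N and all indices λ, μ, ν in Fin n, the following identity holds in the polynomial ring k[X_1,…,X_n]: ∑_{p+q=N+1} (1/p!)·((−1)^q B_q/q!) · ∑_ρ δ_ρ((𝒞^p)^λ_μ) · (𝒞^q)^ρ_ν = (1/N!) · ∑_ρ C^ρ_{μν} · (𝒞^N)^λ_ρ, where the outer sum is over pairs of natural numbers (p,q) with p+q = N+1. (This is the degree-N homogeneous component of the power-series identity (δ_ρ 𝒪^λ_μ) φ^ρ_ν = C^ρ_{μν} 𝒪^λ_ρ, which expresses the commutator identity [𝒪^λ_μ, x̂_ν] = C^ρ_{μν} 𝒪^λ_ρ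 of Theorem 2.2, equation (10), in the realization x̂_ν = x_ρ φ^ρ_ν.) -/
open Finset MvPolynomial

/-- The coefficients of `β(Tz) (e^{Lz} - e^{Rz}) = T z e^{Lz}` with `T = L - R` and
`β(z) = z e^z / (e^z - 1)`. -/
theorem sum_bernoulli'_mul_pow_sub_pow {A : Type*} [CommRing A] [Algebra ℚ A] (L R : A) (N : ℕ) :
    ∑ pq ∈ antidiagonal (N + 1),
        algebraMap ℚ A (1 / pq.1.factorial * (bernoulli' pq.2 / pq.2.factorial)) *
          ((L ^ pq.1 - R ^ pq.1) * (L - R) ^ pq.2)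
      = algebraMap ℚ A (1 / N.factorial) * (L ^ N * (L - R)) := by
  have h := congrArg (PowerSeries.rescale (L - R)) (bernoulli'PowerSeries_mul_exp_sub_one A)
  have h2 := PowerSeries.exp_mul_exp_eq_exp_add (A := A) (L - R) R
  rw [sub_add_cancel] at h2
  have h3 : (PowerSeries.rescale L (PowerSeries.exp A) - PowerSeries.rescale R (PowerSeries.exp A))
      * PowerSeries.rescale (L - R) (bernoulli'PowerSeries A)
      = PowerSeries.rescale (L - R) PowerSeries.X * PowerSeries.rescale L (PowerSeries.exp A) := by
    simp only [map_mul, map_sub, map_one] at h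
    rw [← h2]
    linear_combination (PowerSeries.rescale R (PowerSeries.exp A)) * h
  have h4 := congrArg (PowerSeries.coeff (N + 1)) h3
  rw [PowerSeries.coeff_mul, PowerSeries.rescale_X, mul_assoc, PowerSeries.coeff_C_mul,
    PowerSeries.coeff_succ_X_mul] at h4
  simp only [map_sub, PowerSeries.coeff_rescale, PowerSeries.coeff_exp, bernoulli'PowerSeries,
    PowerSeries.coeff_mk] at h4
  calc _ = _ := sum_congr rfl fun pq _ => ?_
    _ = _ := h4
    _ = _ := by ring
  rw [map_mul]
  ring

/-- The previous identity divided by `L - R`, for commuting elements of any `ℚ`-algebra. -/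
theorem Commute.sum_bernoulli'_mul_geom_sum {E : Type*} [Ring E] [Algebra ℚ E] {L R : E}
    (hLR : Commute L R) (N : ℕ) :
    ∑ pq ∈ antidiagonal (N + 1),
        algebraMap ℚ E (1 / pq.1.factorial * (bernoulli' pq.2 / pq.2.factorial)) *
          ((∑ i ∈ range pq.1, L ^ i * R ^ (pq.1 - 1 - i)) * (L - R) ^ pq.2)
      = algebraMap ℚ E (1 / N.factorial) * L ^ N := by
  let x : Polynomial (Polynomial ℚ) := Polynomial.C Polynomial.X
  let y : Polynomial (Polynomial ℚ) := Polynomial.X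
  have hxy : x - y ≠ 0 := by
    rw [← neg_ne_zero, neg_sub]
    exact Polynomial.X_sub_C_ne_zero _
  have key : ∑ pq ∈ antidiagonal (N + 1),
        algebraMap ℚ (Polynomial (Polynomial ℚ))
            (1 / pq.1.factorial * (bernoulli' pq.2 / pq.2.factorial)) *
          ((∑ i ∈ range pq.1, x ^ i * y ^ (pq.1 - 1 - i)) * (x - y) ^ pq.2)
      = algebraMap ℚ (Polynomial (Polynomial ℚ)) (1 / N.factorial) * x ^ N := by
    apply mul_right_cancel₀ hxy
    rw [mul_assoc, ← sum_bernoulli'_mul_pow_sub_pow, sum_mul]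
    refine sum_congr rfl fun pq _ => ?_
    rw [← geom_sum₂_mul]
    ring
  let f : Polynomial (Polynomial ℚ) →+* E :=
    Polynomial.eval₂RingHom' (Polynomial.aeval L : Polynomial ℚ →ₐ[ℚ] E).toRingHom R fun a => by
      induction a using Polynomial.induction_on' with
      | add p q hp hq => rw [map_add]; exact hp.add_left hq
      | monomial m a =>
        simpa [Polynomial.aeval_monomial] using
          (Algebra.commute_algebraMap_left a R).mul_left (hLR.pow_left m)
  have hx : f x = L := by simp [f, x, Polynomial.eval₂RingHom']
  have hy : f y = R := by simp [f, y, Polynomial.eval₂RingHom']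
  have hq (a : ℚ) : f (algebraMap ℚ _ a) = algebraMap ℚ E a :=
    RingHom.congr_fun (RingHom.ext_rat (f.comp (algebraMap ℚ _)) (algebraMap ℚ E)) a
  have h := congrArg f key
  simpa only [map_sum, map_mul f, map_pow, map_sub, hq, hx, hy] using h

/-- The previous identity for left and right multiplication by `a`, whose difference is `ad a`. -/
theorem sum_bernoulli'_smul_geom_sum_ad {S : Type*} [Ring S] [Algebra ℚ S] (a x : S) (N : ℕ) :
    ∑ pq ∈ antidiagonal (N + 1),
        (1 / pq.1.factorial * (bernoulli' pq.2 / pq.2.factorial) : ℚ) •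
          ∑ i ∈ range pq.1, a ^ i *
            ((LinearMap.mulLeft ℚ a - LinearMap.mulRight ℚ a) ^ pq.2) x * a ^ (pq.1 - 1 - i)
      = (1 / N.factorial : ℚ) • (a ^ N * x) := by
  have h := LinearMap.congr_fun
    ((LinearMap.commute_mulLeft_right (R := ℚ) a a).sum_bernoulli'_mul_geom_sum N) x
  simpa [LinearMap.sum_apply, ← Algebra.smul_def, LinearMap.pow_mulLeft, LinearMap.pow_mulRight,
    mul_smul, mul_assoc] using h

theorem Derivation.map_matrix_pow {k R m : Type*} [CommRing k] [CommRing R] [Algebra k R]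
    [Fintype m] [DecidableEq m] (D : Derivation k R R) (M : Matrix m m R) (p : ℕ) :
    (M ^ p).map D = ∑ i ∈ range p, M ^ i * M.map D * M ^ (p - 1 - i) := by
  have hmul (A B : Matrix m m R) : (A * B).map D = A.map D * B + A * B.map D := by
    ext i j
    simp only [Matrix.map_apply, Matrix.mul_apply, Matrix.add_apply, map_sum, Derivation.leibniz,
      smul_eq_mul, sum_add_distrib]
    rw [add_comm]
    simp only [mul_comm]
  induction p with
  | zero =>
    ext i j
    by_cases hij : i = j <;> simp [hij]
  | succ p ih =>
    rw [pow_succ, hmul, ih, sum_range_succ, sum_mul]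
    congr 1
    · refine sum_congr rfl fun i hi => ?_
      rw [mul_assoc _ _ M, ← pow_succ]
      congr 2
      have := mem_range.mp hi
      omega
    · simp

/-- The matrix `v ↦ (w ↦ [w, v])` of the bracket with structure constants `c`. -/
def bracketMatrix {R m : Type*} [CommRing R] [Fintype m] (c : m → m → m → R) (v : m → R) :
    Matrix m m R :=
  .of fun a b => ∑ r, c a b r * v r

/-- The Jacobi identity in the form `[·, [v, x]] = [[·, v], x] - [[·, x], v]`. -/
theorem bracketMatrix_mulVec {R m : Type*} [CommRing R] [Fintype m] (c : m → m → m → R)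
    (hanti : ∀ l μ ν, c l μ ν = - c l ν μ)
    (hjac : ∀ μ ν τ σ, ∑ ρ, (c ρ μ ν * c σ ρ τ + c ρ ν τ * c σ ρ μ + c ρ τ μ * c σ ρ ν) = 0)
    (x v : m → R) :
    bracketMatrix c ((bracketMatrix c x).mulVec v) =
      bracketMatrix c x * bracketMatrix c v - bracketMatrix c v * bracketMatrix c x := by
  ext a b
  have h : ∀ s g, ∑ r, c a b r * c r s g = ∑ r, c a r g * c r b s - ∑ r, c a r s * c r b g := by
    intro s g
    rw [← sum_sub_distrib, ← sub_eq_zero, ← sum_sub_distrib, ← neg_eq_zero, ← sum_neg_distrib,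
      ← hjac b s g a]
    refine sum_congr rfl fun r _ => ?_
    rw [hanti a b r, hanti r g b]
    ring
  have e1 : bracketMatrix c ((bracketMatrix c x).mulVec v) a b =
      ∑ s, ∑ g, (∑ r, c a b r * c r s g) * (x g * v s) := by
    simp only [bracketMatrix, Matrix.of_apply, Matrix.mulVec, dotProduct, mul_sum, sum_mul]
    rw [sum_comm]
    refine sum_congr rfl fun s _ => ?_
    rw [sum_comm]
    refine sum_congr rfl fun g _ => sum_congr rfl fun r _ => ?_
    ring
  have e2 (y z : m → R) : (bracketMatrix c y * bracketMatrix c z) a b =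
      ∑ s, ∑ g, (∑ r, c a r g * c r b s) * (y g * z s) := by
    simp only [bracketMatrix, Matrix.of_apply, Matrix.mul_apply, mul_sum, sum_mul]
    rw [sum_comm]
    refine sum_congr rfl fun s _ => ?_
    rw [sum_comm]
    refine sum_congr rfl fun g _ => sum_congr rfl fun r _ => ?_
    ring
  rw [Matrix.sub_apply, e1, e2, e2 v x, sum_comm (s := univ) (t := univ)
    (f := fun s g => (∑ r, c a r g * c r b s) * (v g * x s)), ← sum_sub_distrib]
  refine sum_congr rfl fun s _ => ?_
  rw [← sum_sub_distrib]
  refine sum_congr rfl fun g _ => ?_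
  rw [h]
  ring

theorem bracketMatrix_pow_mulVec {R m : Type*} [CommRing R] [Algebra ℚ R] [Fintype m]
    [DecidableEq m] (c : m → m → m → R) (hanti : ∀ l μ ν, c l μ ν = - c l ν μ)
    (hjac : ∀ μ ν τ σ, ∑ ρ, (c ρ μ ν * c σ ρ τ + c ρ ν τ * c σ ρ μ + c ρ τ μ * c σ ρ ν) = 0)
    (x v : m → R) (q : ℕ) :
    bracketMatrix c ((bracketMatrix c x ^ q).mulVec v) =
      ((LinearMap.mulLeft ℚ (bracketMatrix c x) - LinearMap.mulRight ℚ (bracketMatrix c x)) ^ q)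
        (bracketMatrix c v) := by
  induction q with
  | zero => simp
  | succ q ih =>
    rw [pow_succ', ← Matrix.mulVec_mulVec, bracketMatrix_mulVec c hanti hjac, ih, pow_succ']
    simp

/-- Degree-`N` homogeneous component of `(δ_ρ 𝒪^λ_μ) φ^ρ_ν = C^ρ_{μν} 𝒪^λ_ρ`,
where `𝒪 = e^𝒞 = ∑_p (1/p!) 𝒞^p` and `φ = ∑_p ((−1)^p B_p/p!) 𝒞^p`
(the realization of identity (10) of Theorem 2.2). -/
theorem statement9 (k : Type*) [Field k] [CharZero k] (n : ℕ)
    (C : Fin n → Fin n → Fin n → k)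
    (hanti : ∀ l μ ν, C l μ ν = - C l ν μ)
    (hjac : ∀ μ ν τ σ, ∑ ρ, (C ρ μ ν * C σ ρ τ + C ρ ν τ * C σ ρ μ + C ρ τ μ * C σ ρ ν) = 0)
    (𝒞 : Matrix (Fin n) (Fin n) (MvPolynomial (Fin n) k))
    (h𝒞 : ∀ α β, 𝒞 α β = ∑ g, MvPolynomial.C (C α β g) * X g)
    (N : ℕ) (l μ ν : Fin n) :
    ∑ pq ∈ antidiagonal (N + 1),
        MvPolynomial.C (((1 / pq.1.factorial) *
            ((-1) ^ pq.2 * bernoulli pq.2 / pq.2.factorial) : ℚ) : k) *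
          ∑ ρ, pderiv ρ ((𝒞 ^ pq.1) l μ) * (𝒞 ^ pq.2) ρ ν
      = MvPolynomial.C ((1 / N.factorial : ℚ) : k) *
          ∑ ρ, MvPolynomial.C (C ρ μ ν) * (𝒞 ^ N) l ρ := by
  let c : Fin n → Fin n → Fin n → MvPolynomial (Fin n) k := fun a b g => MvPolynomial.C (C a b g)
  have hc𝒞 : 𝒞 = bracketMatrix c X := by
    ext1 a b
    exact h𝒞 a b
  have hcanti (a b g) : c a b g = - c a g b := by
    simp only [c, ← map_neg, ← hanti]
  have hcjac (a b g s) :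
      ∑ r, (c r a b * c s r g + c r b g * c s r a + c r g a * c s r b) = 0 := by
    simp only [c, ← map_mul, ← map_add, ← map_sum, hjac, map_zero]
  have hsmul (a : ℚ) (f : MvPolynomial (Fin n) k) : MvPolynomial.C (a : k) * f = a • f := by
    rw [Algebra.smul_def, IsScalarTower.algebraMap_apply ℚ k, MvPolynomial.algebraMap_eq,
      eq_ratCast]
  have hderiv (p q : ℕ) : ∑ ρ, pderiv ρ ((𝒞 ^ p) l μ) * (𝒞 ^ q) ρ ν =
      (∑ i ∈ range p, 𝒞 ^ i * ((LinearMap.mulLeft ℚ 𝒞 - LinearMap.mulRight ℚ 𝒞) ^ q)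
        (bracketMatrix c (Pi.single ν 1)) * 𝒞 ^ (p - 1 - i)) l μ := by
    let v : Fin n → MvPolynomial (Fin n) k := (𝒞 ^ q).mulVec (Pi.single ν 1)
    have hv (r) : v r = (𝒞 ^ q) r ν := by simp [v]
    let D : Derivation k (MvPolynomial (Fin n) k) (MvPolynomial (Fin n) k) :=
      MvPolynomial.mkDerivation k v
    have hD (f) : D f = ∑ r, pderiv r f * v r := by
      have hsum (g) : (∑ r, v r • pderiv r : Derivation k (MvPolynomial (Fin n) k) _) g =
          ∑ r, pderiv r g * v r := by
        rw [← Derivation.coeFnAddMonoidHom_apply, map_sum, Finset.sum_apply]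
        simp [mul_comm]
      rw [← hsum f]
      congr 1
      refine MvPolynomial.derivation_ext fun i => ?_
      rw [hsum]
      simp [D, MvPolynomial.mkDerivation_X, pderiv_X, Pi.single_apply]
    have hD𝒞 : 𝒞.map D = bracketMatrix c v := by
      ext1 a b
      simp [h𝒞, bracketMatrix, c, D, MvPolynomial.mkDerivation_X]
    have h1 := congrFun (congrFun (D.map_matrix_pow 𝒞 p) l) μ
    rw [Matrix.map_apply, hD, hD𝒞] at h1
    simp only [hv] at h1
    rw [h1]
    simp only [v, hc𝒞, bracketMatrix_pow_mulVec c hcanti hcjac]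
  have h := congrFun (congrFun
    (sum_bernoulli'_smul_geom_sum_ad 𝒞 (bracketMatrix c (Pi.single ν 1)) N) l) μ
  simp only [hsmul, hderiv]
  rw [Matrix.sum_apply] at h
  refine Eq.trans (sum_congr rfl fun pq _ => ?_) (h.trans ?_)
  · rw [Matrix.smul_apply, ← bernoulli'_eq_bernoulli]
  · rw [Matrix.smul_apply, Matrix.mul_apply]
    congr 1
    refine sum_congr rfl fun r _ => ?_
    simp [bracketMatrix, c, Pi.single_apply, mul_comm]
end
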